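/- Let A be an integer m×n matrix with rows a₁, …, a_m, and define Δ^{UB} = lcm{1, 2, …, ⌊∏_{i=1}^m max(1, ‖a_i‖₂)⌋}. Then A is Δ^{UB}-regular. -/

import Mathlib

/-- A rational matrix `A` is `Δ`-regular if for every nonsingular square submatrix `R`
of `A`, the matrix `Δ • R⁻¹` has all entries in `ℤ`. -/
def IsDeltaRegular {m n : Type*} (A : Matrix m n ℚ) (Δ : ℕ) : Prop :=
  ∀ (w : ℕ) (r : Fin w → m) (c : Fin w → n),
    Function.Injective r → Function.Injective c →
    (A.submatrix r c).det ≠ 0 →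
    ∀ i j, ∃ z : ℤ, (Δ : ℚ) * (A.submatrix r c)⁻¹ i j = (z : ℚ)

/-- **Hadamard's inequality** for the rows of a real square matrix. -/
theorem Matrix.abs_det_le_prod_sqrt_sum_sq {n : ℕ} (M : Matrix (Fin n) (Fin n) ℝ) :
    |M.det| ≤ ∏ i, Real.sqrt (∑ j, M i j ^ 2) := by
  let b := EuclideanSpace.basisFun (Fin n) ℝ
  have : Fact (Module.finrank ℝ (EuclideanSpace ℝ (Fin n)) = n) := ⟨by simp⟩
  let v : Fin n → EuclideanSpace ℝ (Fin n) := fun i => WithLp.toLp 2 (M i)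
  have h := b.toBasis.orientation.abs_volumeForm_apply_le v
  rw [b.toBasis.orientation.volumeForm_robust b rfl, Module.Basis.det_apply] at h
  have hM : b.toBasis.toMatrix v = M.transpose := by
    ext i j
    simp [b, v, Module.Basis.toMatrix_apply]
  rw [hM, Matrix.det_transpose] at h
  simpa [v, EuclideanSpace.norm_eq] using h

/-- The determinant of a square submatrix is at most the product of the row norms, each
replaced by `1` if smaller. -/
theorem Matrix.abs_det_submatrix_le_prod_max_one {m n w : ℕ} (M : Matrix (Fin m) (Fin n) ℝ)
    {r : Fin w → Fin m} {c : Fin w → Fin n}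
    (hr : Function.Injective r) (hc : Function.Injective c) :
    |(M.submatrix r c).det| ≤ ∏ i, max 1 (Real.sqrt (∑ j, M i j ^ 2)) := by
  calc |(M.submatrix r c).det|
      ≤ ∏ k, Real.sqrt (∑ l, M (r k) (c l) ^ 2) :=
        (M.submatrix r c).abs_det_le_prod_sqrt_sum_sq
    _ ≤ ∏ k, max 1 (Real.sqrt (∑ j, M (r k) j ^ 2)) := by
        refine Finset.prod_le_prod (fun _ _ => Real.sqrt_nonneg _) fun k _ => ?_
        refine le_max_of_le_right (Real.sqrt_le_sqrt ?_)
        rw [← Finset.sum_image (f := fun j => M (r k) j ^ 2) hc.injOn]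
        exact Finset.sum_le_sum_of_subset_of_nonneg (Finset.subset_univ _)
          fun _ _ _ => sq_nonneg _
    _ ≤ ∏ i, max 1 (Real.sqrt (∑ j, M i j ^ 2)) := by
        rw [← Finset.prod_image (f := fun i => max 1 (Real.sqrt (∑ j, M i j ^ 2))) hr.injOn]
        exact Finset.prod_le_prod_of_subset_of_one_le (Finset.subset_univ _)
          (fun _ _ => by positivity) fun _ _ _ => le_max_left _ _

/-- If `det B` divides `Δ`, then `Δ • B⁻¹` has integer entries. -/
theorem Matrix.exists_int_eq_mul_inv_of_det_dvd {ι : Type*} [Fintype ι] [DecidableEq ι]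
    (B : Matrix ι ι ℤ) (hB : B.det ≠ 0) {Δ : ℤ} (hΔ : B.det ∣ Δ) (i j : ι) :
    ∃ z : ℤ, (Δ : ℚ) * (B.map (fun z => (z : ℚ)))⁻¹ i j = z := by
  obtain ⟨k, rfl⟩ := hΔ
  have hdet : (B.map (fun z => (z : ℚ))).det = (B.det : ℚ) :=
    ((Int.castRingHom ℚ).map_det B).symm
  have hadj : (B.map (fun z => (z : ℚ))).adjugate = B.adjugate.map (fun z => (z : ℚ)) :=
    ((Int.castRingHom ℚ).map_adjugate B).symm
  have hB' : (B.det : ℚ) ≠ 0 := Int.cast_ne_zero.mpr hB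
  refine ⟨k * B.adjugate i j, ?_⟩
  rw [Matrix.inv_def, hdet, hadj, Ring.inverse_eq_inv']
  simp only [Matrix.smul_apply, Matrix.map_apply, smul_eq_mul, Int.cast_mul]
  field_simp

/-- An integer `m × n` matrix `A` with rows `a₁, …, a_m` is `Δ^{UB}`-regular, where
`Δ^{UB} = lcm{1, 2, …, ⌊∏_{i=1}^m max(1, ‖a_i‖₂)⌋}`. -/
theorem isDeltaRegular_lcm_hadamard {m n : ℕ} (A : Matrix (Fin m) (Fin n) ℤ) :
    IsDeltaRegular (A.map (fun z => (z : ℚ)))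
      ((Finset.Icc 1
        ⌊∏ i : Fin m, max 1 (Real.sqrt (∑ j : Fin n, ((A i j : ℝ)) ^ 2))⌋₊).lcm id) := by
  intro w r c hr hc hdet i j
  let B := A.submatrix r c
  have hBdet : ((A.map (fun z => (z : ℚ))).submatrix r c).det = (B.det : ℚ) :=
    ((Int.castRingHom ℚ).map_det B).symm
  have hB : B.det ≠ 0 := fun h => hdet (by rw [hBdet, h, Int.cast_zero])
  have hBdet' : ((A.map (fun z => (z : ℝ))).submatrix r c).det = (B.det : ℝ) :=
    ((Int.castRingHom ℝ).map_det B).symm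
  have hle := (A.map (fun z => (z : ℝ))).abs_det_submatrix_le_prod_max_one hr hc
  rw [hBdet'] at hle
  have hmem : B.det.natAbs ∈ Finset.Icc 1
      ⌊∏ i : Fin m, max 1 (Real.sqrt (∑ j : Fin n, ((A i j : ℝ)) ^ 2))⌋₊ := by
    refine Finset.mem_Icc.mpr ⟨Int.natAbs_pos.mpr hB, Nat.le_floor ?_⟩
    rw [Nat.cast_natAbs, Int.cast_abs]
    exact hle
  exact B.exists_int_eq_mul_inv_of_det_dvd hB
    (Int.natAbs_dvd.mp (Int.natCast_dvd_natCast.mpr (Finset.dvd_lcm (f := id) hmem))) i j
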